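/- Let p be an odd prime, α ∈ ℤ_p, and z ∈ ℤ_p^× with z + 1 ∈ ℤ_p^×. Set λ = λ_p^{(2)}(α). Then ∑_{k=0}^{p−1} (α)_k²/(k!)² · z^k + z^{1−λ} · ∑_{k=0}^{p−1} (α)_k²/(k!)² · z^{−k} ≡ (1+z)^{1−λ} · ∑_{k=0}^{p−1} (α/2)_k((1+α)/2)_k/(k!)² · (4z/(1+z)²)^k (mod p²). -/

import Mathlib

open scoped BigOperators

/-- The Pochhammer symbol `(x)_k = x(x+1)⋯(x+k-1)` in `ℚ_[p]`. -/
noncomputable def poch (p : ℕ) [Fact p.Prime] (x : ℚ_[p]) (k : ℕ) : ℚ_[p] :=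
  (ascPochhammer ℚ_[p] k).eval x

/-- The least non-negative residue `⟨α⟩_p ∈ {0,…,p-1}` of `α ∈ ℤ_[p]` modulo `p`. -/
noncomputable def res (p : ℕ) [Fact p.Prime] (α : ℤ_[p]) : ℕ :=
  (PadicInt.toZMod α).val

/-- The least non-negative residue `⟨α⟩_{p²} ∈ {0,…,p²-1}` of `α ∈ ℤ_[p]` modulo `p²`. -/
noncomputable def res2 (p : ℕ) [Fact p.Prime] (α : ℤ_[p]) : ℕ :=
  (PadicInt.toZModPow 2 α).val

/-- `λ_p^{(2)}(α) = ((⟨−α⟩_p − ⟨−α⟩_{p²})/p)·(p−1) − ⟨−α⟩_p`, an integer congruent mod `p²`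
to the exponent `λ_p(α)` of the paper on units. -/
noncomputable def lam2 (p : ℕ) [Fact p.Prime] (α : ℤ_[p]) : ℤ :=
  (((res p (-α) : ℤ) - (res2 p (-α) : ℤ)) / (p : ℤ)) * ((p : ℤ) - 1) - (res p (-α) : ℤ)

open Polynomial in
/-- `∑ C(N,k)² z^k = ∑ C(N,2k) C(2k,k) z^k (1+z)^(N-2k)`, by comparing coefficients of `X^N` in
`(X+1)^N (X+z)^N = ((1+z)X + (X²+z))^N`. -/
theorem sum_choose_sq_mul_pow {R : Type*} [CommRing R] (z : R) (N M : ℕ) (hM : N < 2 * M) :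
    ∑ k ∈ Finset.range (N + 1), (N.choose k : R) ^ 2 * z ^ k =
      ∑ k ∈ Finset.range M,
        (N.choose (2 * k) : R) * ((2 * k).choose k : R) * z ^ k * (1 + z) ^ (N - 2 * k) := by
  have hpoly : ((X + C 1) ^ N * (X + C z) ^ N : R[X]) =
      ((X ^ 2 + C z) + C (1 + z) * X) ^ N := by
    rw [← mul_pow]
    congr 1
    simp only [map_add, map_one]
    ring
  have hcoeff := congrArg (fun P : R[X] => P.coeff N) hpoly
  rw [coeff_mul, Finset.Nat.sum_antidiagonal_eq_sum_range_succ_mk, add_pow (X ^ 2 + C z), finsetSum_coeff]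
    at hcoeff
  have hleft : ∀ k ∈ Finset.range (N + 1),
      ((X + C (1 : R)) ^ N).coeff k * ((X + C z) ^ N).coeff (N - k) =
        (N.choose k : R) ^ 2 * z ^ k := by
    intro k hk
    have hk' : k ≤ N := Nat.lt_succ_iff.mp (Finset.mem_range.mp hk)
    rw [coeff_X_add_C_pow, coeff_X_add_C_pow, Nat.sub_sub_self hk', Nat.choose_symm hk']
    ring
  have hright : ∀ j ∈ Finset.range (N + 1),
      ((X ^ 2 + C z) ^ j * (C (1 + z) * X) ^ (N - j) * ((N.choose j : ℕ) : R[X])).coeff N =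
        (N.choose j : R) * (1 + z) ^ (N - j) *
          (if 2 ∣ j then z ^ (j - j / 2) * (j.choose (j / 2) : R) else 0) := by
    intro j hj
    have hj' : j ≤ N := Nat.lt_succ_iff.mp (Finset.mem_range.mp hj)
    have hexp : (X ^ 2 + C z : R[X]) ^ j = expand R 2 ((X + C z) ^ j) := by simp
    rw [mul_pow, ← C_pow, ← C_eq_natCast,
      show (X ^ 2 + C z) ^ j * (C ((1 + z) ^ (N - j)) * X ^ (N - j)) * C (N.choose j : R) =
        C ((N.choose j : R) * (1 + z) ^ (N - j)) * ((X ^ 2 + C z) ^ j * X ^ (N - j)) by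
        rw [C_mul]; ring,
      coeff_C_mul, coeff_mul_X_pow', if_pos (Nat.sub_le _ _), Nat.sub_sub_self hj', hexp,
      coeff_expand (by norm_num), coeff_X_add_C_pow]
  rw [Finset.sum_congr rfl hleft, Finset.sum_congr rfl hright] at hcoeff
  rw [hcoeff]
  have hext : Finset.range (N + 1) ⊆ Finset.range (2 * M) := by
    intro k hk
    simp only [Finset.mem_range] at hk ⊢
    omega
  rw [Finset.sum_subset hext]
  · have hsplit : ∀ (g : ℕ → R) (m : ℕ), ∑ j ∈ Finset.range (2 * m), g j =
        ∑ k ∈ Finset.range m, (g (2 * k) + g (2 * k + 1)) := by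
      intro g m
      induction m with
      | zero => simp
      | succ m ih =>
        rw [show 2 * (m + 1) = 2 * m + 1 + 1 by ring, Finset.sum_range_succ,
          Finset.sum_range_succ, Finset.sum_range_succ, ih]
        ring
    rw [hsplit]
    refine Finset.sum_congr rfl fun k _ => ?_
    rw [if_pos (dvd_mul_right 2 k), if_neg (by omega), show 2 * k / 2 = k by omega,
      show 2 * k - k = k by omega]
    ring
  · intro j _ hj
    rw [Nat.choose_eq_zero_of_lt (by simpa using hj)]
    simp

/-- Sequences of the form `s ↦ a + π d s`. -/
def IsAffineIn {R : Type*} [CommRing R] (π : R) (f : ℕ → R) : Prop :=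
  ∃ a d : R, ∀ s : ℕ, f s = a + π * d * s

namespace IsAffineIn

variable {R : Type*} [CommRing R] {π : R} {f g : ℕ → R}

theorem const (a : R) : IsAffineIn π (fun _ => a) := ⟨a, 0, fun s => by ring⟩

theorem add (hf : IsAffineIn π f) (hg : IsAffineIn π g) : IsAffineIn π (fun s => f s + g s) := by
  obtain ⟨a, d, h⟩ := hf
  obtain ⟨b, e, h'⟩ := hg
  exact ⟨a + b, d + e, fun s => by simp only [h, h']; ring⟩

theorem mul (hπ : π ^ 2 = 0) (hf : IsAffineIn π f) (hg : IsAffineIn π g) :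
    IsAffineIn π (fun s => f s * g s) := by
  obtain ⟨a, d, h⟩ := hf
  obtain ⟨b, e, h'⟩ := hg
  exact ⟨a * b, a * e + b * d, fun s => by simp only [h, h']; linear_combination (d * e * s ^ 2) * hπ⟩

theorem sub (hπ : π ^ 2 = 0) (hf : IsAffineIn π f) (hg : IsAffineIn π g) :
    IsAffineIn π (fun s => f s - g s) := by
  simpa [sub_eq_add_neg] using hf.add ((const (-1)).mul hπ hg)

theorem sum {ι : Type*} (t : Finset ι) {F : ι → ℕ → R} (hF : ∀ i ∈ t, IsAffineIn π (F i)) :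
    IsAffineIn π (fun s => ∑ i ∈ t, F i s) := by
  classical
  induction t using Finset.induction_on with
  | empty => simpa using const (0 : R)
  | insert i t hi ih =>
    simp only [Finset.sum_insert hi]
    exact (hF i (by simp)).add (ih fun j hj => hF j (by simp [hj]))

theorem ascPochhammer_eval (hπ : π ^ 2 = 0) (hf : IsAffineIn π f) (k : ℕ) :
    IsAffineIn π (fun s => (ascPochhammer R k).eval (f s)) := by
  induction k with
  | zero => simpa using const (1 : R)
  | succ k ih =>
    simp only [ascPochhammer_succ_eval]
    exact ih.mul hπ (hf.add (const _))

theorem one_add_pow (hπ : π ^ 2 = 0) (c : R) : IsAffineIn π (fun s => (1 + π * c) ^ s) := by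
  refine ⟨1, c, fun s => ?_⟩
  beta_reduce
  induction s with
  | zero => simp
  | succ s ih =>
    rw [pow_succ, ih]
    push_cast
    linear_combination c ^ 2 * s * hπ

theorem eq_zero (hf : IsAffineIn π f) (h0 : f 0 = 0) (h1 : f 1 = 0) (s : ℕ) : f s = 0 := by
  obtain ⟨a, d, h⟩ := hf
  have h0' := h 0
  have h1' := h 1
  rw [h0] at h0'
  rw [h1] at h1'
  push_cast at h0' h1'
  rw [h]
  linear_combination (s - 1 : R) * h0' - s * h1'

end IsAffineIn

section Truncated

variable {R : Type*} [CommRing R]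

theorem ascPochhammer_eval_neg_natCast (N k : ℕ) :
    (ascPochhammer R k).eval (-(N : R)) = (-1) ^ k * ((k.factorial : R) * (N.choose k : R)) := by
  rw [ascPochhammer_eval_neg_eq_descPochhammer, descPochhammer_eval_eq_descFactorial,
    Nat.descFactorial_eq_factorial_mul_choose]
  push_cast
  ring

/-- The difference of the two sides of the truncated quadratic transformation, with `z'`, `y'`,
`f k` standing for `z⁻¹`, `(1+z)⁻¹`, `(k!)⁻¹`, and `e` for the exponent. -/
noncomputable def truncatedDefect (p e : ℕ) (x z z' y' : R) (f : ℕ → R) : R :=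
  (∑ k ∈ Finset.range p, (ascPochhammer R k).eval x ^ 2 * f k ^ 2 * z ^ k)
    + z ^ e * ∑ k ∈ Finset.range p, (ascPochhammer R k).eval x ^ 2 * f k ^ 2 * z' ^ k
    - (1 + z) ^ e * ∑ k ∈ Finset.range p,
        (ascPochhammer R (2 * k)).eval x * f k ^ 2 * (z * y' ^ 2) ^ k

theorem map_truncatedDefect {S : Type*} [CommRing S] (φ : R →+* S) (p e : ℕ) (x z z' y' : R)
    (f : ℕ → R) :
    φ (truncatedDefect p e x z z' y' f) =
      truncatedDefect p e (φ x) (φ z) (φ z') (φ y') (fun k => φ (f k)) := by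
  have h : ∀ k, φ ((ascPochhammer R k).eval x) = (ascPochhammer S k).eval (φ x) := fun k => by
    rw [← ascPochhammer_map φ k, Polynomial.eval_map_apply]
  simp [truncatedDefect, h]

variable {p : ℕ} {z z' y' : R} {f : ℕ → R}

theorem truncatedDefect_neg_natCast (hf : ∀ k < p, (k.factorial : R) * f k = 1) (e N : ℕ) :
    truncatedDefect p e (-(N : R)) z z' y' f =
      (∑ k ∈ Finset.range p, (N.choose k : R) ^ 2 * z ^ k)
        + z ^ e * ∑ k ∈ Finset.range p, (N.choose k : R) ^ 2 * z' ^ k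
        - (1 + z) ^ e * ∑ k ∈ Finset.range p,
            (N.choose (2 * k) : R) * ((2 * k).choose k : R) * (z * y' ^ 2) ^ k := by
  have hsq : ∀ k ∈ Finset.range p,
      (ascPochhammer R k).eval (-(N : R)) ^ 2 * f k ^ 2 = (N.choose k : R) ^ 2 := by
    intro k hk
    have h1 := hf k (Finset.mem_range.mp hk)
    have h2 : ((-1 : R) ^ k) ^ 2 = 1 := by rw [← pow_mul, mul_comm, pow_mul]; simp
    rw [ascPochhammer_eval_neg_natCast]
    calc _ = ((-1 : R) ^ k) ^ 2 * ((k.factorial : R) * f k) ^ 2 * (N.choose k : R) ^ 2 := by ring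
      _ = _ := by rw [h1, h2]; ring
  have hmid : ∀ k ∈ Finset.range p, (ascPochhammer R (2 * k)).eval (-(N : R)) * f k ^ 2 =
      (N.choose (2 * k) : R) * ((2 * k).choose k : R) := by
    intro k hk
    have h1 := hf k (Finset.mem_range.mp hk)
    have h2 : ((-1 : R) ^ (2 * k)) = 1 := by rw [pow_mul]; simp
    have h3 : ((2 * k).factorial : R) =
        ((2 * k).choose k : R) * (k.factorial : R) * (k.factorial : R) := by
      have := Nat.choose_mul_factorial_mul_factorial (show k ≤ 2 * k by omega)
      rw [show 2 * k - k = k by omega] at this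
      rw [← this]
      push_cast
      rfl
    rw [ascPochhammer_eval_neg_natCast, h2, h3]
    calc _ = ((k.factorial : R) * f k) ^ 2 *
          ((N.choose (2 * k) : R) * ((2 * k).choose k : R)) := by ring
      _ = _ := by rw [h1]; ring
  unfold truncatedDefect
  congr 1
  · congr 1
    · exact Finset.sum_congr rfl fun k hk => by rw [hsq k hk]
    · congr 1
      exact Finset.sum_congr rfl fun k hk => by rw [hsq k hk]
  · congr 1
    exact Finset.sum_congr rfl fun k hk => by rw [hmid k hk]

theorem one_add_pow_mul_sum_choose (hy : (1 + z) * y' = 1) (N : ℕ) (hN : N < 2 * p) :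
    (1 + z) ^ N * ∑ k ∈ Finset.range p,
        (N.choose (2 * k) : R) * ((2 * k).choose k : R) * (z * y' ^ 2) ^ k =
      ∑ k ∈ Finset.range (N + 1), (N.choose k : R) ^ 2 * z ^ k := by
  rw [sum_choose_sq_mul_pow z N p hN, Finset.mul_sum]
  refine Finset.sum_congr rfl fun k _ => ?_
  rcases le_or_gt (2 * k) N with h | h
  · have h1 : (1 + z) ^ N = (1 + z) ^ (N - 2 * k) * (1 + z) ^ (2 * k) := by
      rw [← pow_add, Nat.sub_add_cancel h]
    have h2 : (1 + z) ^ (2 * k) * (y' ^ 2) ^ k = 1 := by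
      rw [← pow_mul, ← mul_pow, hy, one_pow]
    rw [h1, mul_pow]
    linear_combination
      ((1 + z) ^ (N - 2 * k) * N.choose (2 * k) * (2 * k).choose k * z ^ k) * h2
  · simp [Nat.choose_eq_zero_of_lt h]

/-- Reversing the top `n+1` terms of a sum of `C(N,k)² z^k`. -/
theorem pow_mul_sum_choose_sq (hz : z * z' = 1) (N n : ℕ) (hn : n ≤ N) :
    z ^ N * ∑ k ∈ Finset.range (n + 1), (N.choose k : R) ^ 2 * z' ^ k =
      ∑ k ∈ Finset.range (n + 1), (N.choose (N - n + k) : R) ^ 2 * z ^ (N - n + k) := by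
  rw [← Finset.sum_range_reflect, Finset.mul_sum]
  refine Finset.sum_congr rfl fun k hk => ?_
  have hk' : k ≤ n := Nat.lt_succ_iff.mp (Finset.mem_range.mp hk)
  have h1 : z ^ N = z ^ (N - n + k) * z ^ (n - k) := by
    rw [← pow_add]; congr 1; omega
  have h2 : z ^ (n - k) * z' ^ (n - k) = 1 := by rw [← mul_pow, hz, one_pow]
  rw [show n + 1 - 1 - k = n - k by omega,
    ← Nat.choose_symm (show N - n + k ≤ N by omega),
    show N - (N - n + k) = n - k by omega, h1]
  linear_combination (z ^ (N - n + k) * (N.choose (n - k) : R) ^ 2) * h2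

theorem truncatedDefect_of_lt (hz : z * z' = 1) (hy : (1 + z) * y' = 1)
    (hf : ∀ k < p, (k.factorial : R) * f k = 1) {n : ℕ} (hn : n < p) :
    truncatedDefect p (n + 1) (-(n : R)) z z' y' f = 0 := by
  have htrunc : ∀ w : R, ∑ k ∈ Finset.range p, (n.choose k : R) ^ 2 * w ^ k =
      ∑ k ∈ Finset.range (n + 1), (n.choose k : R) ^ 2 * w ^ k := by
    intro w
    refine (Finset.sum_subset (Finset.range_mono hn) fun k _ hk => ?_).symm
    rw [Nat.choose_eq_zero_of_lt (by simpa using hk)]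
    simp
  have h1 := one_add_pow_mul_sum_choose hy n (show n < 2 * p by omega)
  have h2 := pow_mul_sum_choose_sq hz n n le_rfl
  simp only [Nat.sub_self, zero_add] at h2
  rw [truncatedDefect_neg_natCast hf, htrunc, htrunc, pow_succ, pow_succ]
  linear_combination z * h2 - (1 + z) * h1

theorem truncatedDefect_add_prime [Fact p.Prime] (hp : (p : R) ^ 2 = 0)
    (hz : z * z' = 1) (hy : (1 + z) * y' = 1)
    (hf : ∀ k < p, (k.factorial : R) * f k = 1) {n : ℕ} (hn : n < p) :
    truncatedDefect p (n + p) (-((n + p : ℕ) : R)) z z' y' f = 0 := by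
  have htrunc : ∑ k ∈ Finset.range p, ((n + p).choose k : R) ^ 2 * z' ^ k =
      ∑ k ∈ Finset.range (n + 1), ((n + p).choose k : R) ^ 2 * z' ^ k := by
    refine (Finset.sum_subset (Finset.range_mono hn) fun k hkp hk => ?_).symm
    have hkp' : k < p := Finset.mem_range.mp hkp
    have hnk : n < k := by simpa using hk
    have hdvd : p ∣ (n + p).choose k := by
      have h := Choose.choose_modEq_choose_mod_mul_choose_div_nat (p := p) (n := n + p) (k := k)
      rw [Nat.add_mod_right, Nat.mod_eq_of_lt hn, Nat.mod_eq_of_lt hkp',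
        Nat.choose_eq_zero_of_lt hnk, zero_mul] at h
      exact (Nat.modEq_zero_iff_dvd).mp h
    obtain ⟨c, hc⟩ := hdvd
    rw [hc]
    push_cast
    linear_combination (c ^ 2 * z' ^ k) * hp
  have h1 := one_add_pow_mul_sum_choose hy (n + p) (show n + p < 2 * p by omega)
  have h2 := pow_mul_sum_choose_sq hz (n + p) n (by omega)
  rw [show n + p + 1 = p + (n + 1) by ring, Finset.sum_range_add] at h1
  rw [show n + p - n = p by omega] at h2
  rw [truncatedDefect_neg_natCast hf, htrunc]
  linear_combination h2 - h1

/-- The truncated transformation in a ring where `p² = 0`: the defect is affine in `s` and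
vanishes at `s = 0` and `s = 1`. -/
theorem truncatedDefect_eq_zero [Fact p.Prime] (hp : (p : R) ^ 2 = 0)
    (hz : z * z' = 1) (hy : (1 + z) * y' = 1)
    (hf : ∀ k < p, (k.factorial : R) * f k = 1)
    (hzp : (p : R) ∣ z ^ (p - 1) - 1) (hyp : (p : R) ∣ (1 + z) ^ (p - 1) - 1)
    {n : ℕ} (hn : n < p) (s : ℕ) :
    truncatedDefect p (n + 1 + (p - 1) * s) (-((n + p * s : ℕ) : R)) z z' y' f = 0 := by
  have hp1 : 1 ≤ p := (Fact.out : p.Prime).one_le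
  have hx : IsAffineIn (p : R) (fun s => -((n + p * s : ℕ) : R)) :=
    ⟨-n, -1, fun s => by push_cast; ring⟩
  have hpow : ∀ w : R, (p : R) ∣ w ^ (p - 1) - 1 →
      IsAffineIn (p : R) (fun s => w ^ (n + 1 + (p - 1) * s)) := by
    rintro w ⟨c, hc⟩
    have hc' : w ^ (p - 1) = 1 + p * c := by linear_combination hc
    simp only [pow_add w (n + 1), pow_mul, hc']
    exact (IsAffineIn.const _).mul hp (IsAffineIn.one_add_pow hp c)
  have hsq : ∀ w : R, IsAffineIn (p : R) (fun s => ∑ k ∈ Finset.range p,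
      (ascPochhammer R k).eval (-((n + p * s : ℕ) : R)) ^ 2 * f k ^ 2 * w ^ k) := by
    intro w
    refine IsAffineIn.sum _ fun k _ => ?_
    simp only [sq ((ascPochhammer R k).eval _)]
    have h := hx.ascPochhammer_eval hp k
    exact ((h.mul hp h).mul hp (.const _)).mul hp (.const _)
  have haff : IsAffineIn (p : R) (fun s =>
      truncatedDefect p (n + 1 + (p - 1) * s) (-((n + p * s : ℕ) : R)) z z' y' f) := by
    refine ((hsq z).add ((hpow z hzp).mul hp (hsq z'))).sub hp
      ((hpow _ hyp).mul hp (IsAffineIn.sum _ fun k _ => ?_))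
    exact ((hx.ascPochhammer_eval hp (2 * k)).mul hp (.const _)).mul hp (.const _)
  refine haff.eq_zero ?_ ?_ s
  · simpa using truncatedDefect_of_lt hz hy hf hn
  · have h := truncatedDefect_add_prime hp hz hy hf hn
    rw [mul_one, mul_one, show n + 1 + (p - 1) = n + p by omega]
    exact h

end Truncated

theorem poch_half_mul_poch_half (p : ℕ) [Fact p.Prime] (x : ℚ_[p]) (k : ℕ) :
    poch p (x / 2) k * poch p ((1 + x) / 2) k * 4 ^ k = poch p x (2 * k) := by
  unfold poch
  induction k with
  | zero => simp
  | succ k ih =>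
    rw [show 2 * (k + 1) = 2 * k + 1 + 1 by ring]
    simp only [ascPochhammer_succ_eval]
    rw [← ih]
    push_cast
    ring

theorem res_eq_res2_mod (p : ℕ) [Fact p.Prime] (β : ℤ_[p]) : res p β = res2 p β % p := by
  have h2 : β - (res2 p β : ℤ_[p]) ∈ RingHom.ker (PadicInt.toZModPow (p := p) 2) := by
    rw [RingHom.mem_ker, map_sub, map_natCast, res2, ZMod.natCast_zmod_val, sub_self]
  have h1 : β - (res2 p β : ℤ_[p]) ∈ RingHom.ker (PadicInt.toZMod (p := p)) := by
    rw [PadicInt.ker_toZModPow, Ideal.mem_span_singleton] at h2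
    rw [PadicInt.ker_toZMod, PadicInt.maximalIdeal_eq_span_p, Ideal.mem_span_singleton]
    exact (dvd_pow_self _ two_ne_zero).trans h2
  rw [RingHom.mem_ker, map_sub, map_natCast, sub_eq_zero] at h1
  rw [res, h1, ZMod.val_natCast]

theorem one_sub_lam2 (p : ℕ) [Fact p.Prime] (α : ℤ_[p]) :
    1 - lam2 p α = ((res2 p (-α) % p + 1 + (p - 1) * (res2 p (-α) / p) : ℕ) : ℤ) := by
  have hp0 : (p : ℤ) ≠ 0 := by exact_mod_cast (Fact.out : p.Prime).ne_zero
  have hp1 : 1 ≤ p := (Fact.out : p.Prime).one_le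
  have hdm : ((res2 p (-α) % p : ℕ) : ℤ) + p * ((res2 p (-α) / p : ℕ) : ℤ) = res2 p (-α) := by
    exact_mod_cast Nat.mod_add_div _ _
  rw [lam2, res_eq_res2_mod, show ((res2 p (-α) % p : ℕ) : ℤ) - (res2 p (-α) : ℤ) =
    p * (-((res2 p (-α) / p : ℕ) : ℤ)) by linear_combination hdm, Int.mul_ediv_cancel_left _ hp0]
  generalize res2 p (-α) % p = n
  generalize res2 p (-α) / p = s
  push_cast [hp1]
  ring

theorem prime_dvd_unit_pow_sub_one (p : ℕ) [Fact p.Prime] {u : ℤ_[p]} (hu : IsUnit u) :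
    (p : ℤ_[p]) ∣ u ^ (p - 1) - 1 := by
  rw [← Ideal.mem_span_singleton, ← PadicInt.maximalIdeal_eq_span_p, ← PadicInt.ker_toZMod,
    RingHom.mem_ker, map_sub, map_pow, map_one, ZMod.pow_card_sub_one_eq_one, sub_self]
  exact (hu.map PadicInt.toZMod).ne_zero

theorem isUnit_factorial_of_lt (p : ℕ) [Fact p.Prime] {k : ℕ} (hk : k < p) :
    IsUnit (k.factorial : ℤ_[p]) := by
  rw [PadicInt.isUnit_iff, PadicInt.norm_natCast_eq_one_iff]
  exact (Fact.out : p.Prime).coprime_factorial_of_lt hk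

/-- p-adic analogue of `₂F₁[α,α;1|z] = (1+z)^{−α} ₂F₁[α/2,(1+α)/2;1|4z/(1+z)²]` mod `p²`. -/
theorem padic_quadratic_transformation_III
    (p : ℕ) [Fact p.Prime] (hp : Odd p) (α z : ℤ_[p])
    (hz : IsUnit z) (hz1 : IsUnit (z + 1)) :
    ‖(∑ k ∈ Finset.range p,
        poch p (α : ℚ_[p]) k ^ 2 / (Nat.factorial k : ℚ_[p]) ^ 2 * (z : ℚ_[p]) ^ k)
      + (z : ℚ_[p]) ^ (1 - lam2 p α) *
          ∑ k ∈ Finset.range p,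
            poch p (α : ℚ_[p]) k ^ 2 / (Nat.factorial k : ℚ_[p]) ^ 2 * (z : ℚ_[p]) ^ (-(k : ℤ))
      - (1 + (z : ℚ_[p])) ^ (1 - lam2 p α) *
          ∑ k ∈ Finset.range p,
            poch p ((α : ℚ_[p]) / 2) k * poch p ((1 + (α : ℚ_[p])) / 2) k / (Nat.factorial k : ℚ_[p]) ^ 2
              * (4 * (z : ℚ_[p]) / (1 + (z : ℚ_[p])) ^ 2) ^ k‖
      ≤ (p : ℝ) ^ (-2 : ℤ) := by
  have hp2 : p.Prime := Fact.out
  set N := res2 p (-α) with hN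
  obtain ⟨z', hz'⟩ := hz.exists_right_inv
  obtain ⟨y', hy'⟩ := hz1.exists_right_inv
  rw [add_comm] at hy' hz1
  have hfac : ∃ f : ℕ → ℤ_[p], ∀ k < p, (k.factorial : ℤ_[p]) * f k = 1 := by
    choose f hf using fun k : Set.Iio p => (isUnit_factorial_of_lt p k.2).exists_right_inv
    exact ⟨fun k => if h : k < p then f ⟨k, h⟩ else 0, fun k hk => by simpa [hk] using hf ⟨k, hk⟩⟩
  obtain ⟨f, hf⟩ := hfac
  have hzero : PadicInt.toZModPow 2
      (truncatedDefect p (N % p + 1 + (p - 1) * (N / p)) α z z' y' f) = 0 := by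
    have hα : PadicInt.toZModPow 2 α = -((N % p + p * (N / p) : ℕ) : ZMod (p ^ 2)) := by
      rw [Nat.mod_add_div, hN, res2, ZMod.natCast_zmod_val, map_neg, neg_neg]
    have hdvd : ∀ {u : ℤ_[p]}, IsUnit u →
        (p : ZMod (p ^ 2)) ∣ (PadicInt.toZModPow 2 u) ^ (p - 1) - 1 := fun hu => by
      simpa using map_dvd (PadicInt.toZModPow (p := p) 2) (prime_dvd_unit_pow_sub_one p hu)
    rw [map_truncatedDefect, hα]
    refine truncatedDefect_eq_zero ?_ ?_ ?_ ?_ (hdvd hz) ?_ (Nat.mod_lt _ hp2.pos) _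
    · exact_mod_cast ZMod.natCast_self (p ^ 2)
    · rw [← map_mul, hz', map_one]
    · simpa using congrArg (PadicInt.toZModPow (p := p) 2) hy'
    · intro k hk
      simpa using congrArg (PadicInt.toZModPow (p := p) 2) (hf k hk)
    · simpa using hdvd hz1
  rw [← RingHom.mem_ker, PadicInt.ker_toZModPow] at hzero
  have hnorm := (PadicInt.norm_le_pow_iff_mem_span_pow _ 2).mpr hzero
  rw [PadicInt.norm_def] at hnorm
  refine (congrArg norm ?_).trans_le hnorm
  have hzQ : (z' : ℚ_[p]) = (z : ℚ_[p])⁻¹ :=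
    (inv_eq_of_mul_eq_one_right (by exact_mod_cast congrArg ((↑) : ℤ_[p] → ℚ_[p]) hz')).symm
  have hyQ : (y' : ℚ_[p]) = (1 + (z : ℚ_[p]))⁻¹ :=
    (inv_eq_of_mul_eq_one_right (by exact_mod_cast congrArg ((↑) : ℤ_[p] → ℚ_[p]) hy')).symm
  have hfQ : ∀ k ∈ Finset.range p, (f k : ℚ_[p]) = (k.factorial : ℚ_[p])⁻¹ := fun k hk =>
    (inv_eq_of_mul_eq_one_right
      (by exact_mod_cast congrArg ((↑) : ℤ_[p] → ℚ_[p]) (hf k (Finset.mem_range.mp hk)))).symm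
  have hcoe : ((truncatedDefect p (N % p + 1 + (p - 1) * (N / p)) α z z' y' f : ℤ_[p]) : ℚ_[p]) =
      truncatedDefect p (N % p + 1 + (p - 1) * (N / p)) (α : ℚ_[p]) z z' y'
        (fun k => (f k : ℚ_[p])) :=
    map_truncatedDefect (PadicInt.Coe.ringHom (p := p)) _ _ _ _ _ _ _
  rw [hcoe, one_sub_lam2, zpow_natCast, zpow_natCast]
  unfold truncatedDefect
  congr 1
  · congr 1
    · refine Finset.sum_congr rfl fun k hk => ?_
      beta_reduce
      rw [hfQ k hk, poch, inv_pow, div_eq_mul_inv]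
    · congr 1
      refine Finset.sum_congr rfl fun k hk => ?_
      beta_reduce
      rw [hfQ k hk, hzQ, poch, inv_pow, div_eq_mul_inv, zpow_neg, zpow_natCast, inv_pow]
  · congr 1
    refine Finset.sum_congr rfl fun k hk => ?_
    have h := poch_half_mul_poch_half p (α : ℚ_[p]) k
    beta_reduce
    rw [hfQ k hk, hyQ, ← poch, ← h, mul_div_assoc, mul_pow, inv_pow, inv_pow, div_eq_mul_inv,
      div_eq_mul_inv]
    ring
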